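/- arXiv:1606.06848 — 2 statements merged into one kernel-verified Lean document; each statement's English description precedes it below -/
import Mathlib

section
/- Let a, b > 0 and N ∈ ℕ. If 0 ≤ ν ≤ 1/2, then (a^ν b^{1−ν} + a^{1−ν} b^{ν})² + 2ν(a−b)² + S_N(2ν; ab, a²) + S_N(2ν; ab, b²) ≤ (a+b)². If 1/2 ≤ ν ≤ 1, then (a^ν b^{1−ν} + a^{1−ν} b^{ν})² + 2(1−ν)(a−b)² + S_N(2−2ν; ab, a²) + S_N(2−2ν; ab, b²) ≤ (a+b)². -/
open Real Finset

noncomputable def kj (j : ℕ) (ν : ℝ) : ℤ := ⌊(2:ℝ)^(j-1) * ν⌋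

noncomputable def rj (j : ℕ) (ν : ℝ) : ℤ := ⌊(2:ℝ)^j * ν⌋

noncomputable def sj (j : ℕ) (ν : ℝ) : ℝ :=
  (-1:ℝ)^(rj j ν) * (2:ℝ)^(j-1) * ν
    + (-1:ℝ)^(rj j ν + 1) * (⌊((rj j ν : ℝ) + 1)/2⌋ : ℤ)

noncomputable def SS (N : ℕ) (ν a b : ℝ) : ℝ :=
  ∑ j ∈ Finset.Icc 1 N, sj j ν *
    ((b ^ ((2:ℝ)^(j-1) - (kj j ν : ℝ)) * a ^ ((kj j ν : ℝ))) ^ ((1:ℝ)/2^j)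
      - (a ^ ((kj j ν : ℝ) + 1) * b ^ ((2:ℝ)^(j-1) - (kj j ν : ℝ) - 1)) ^ ((1:ℝ)/2^j))^2

/-- The weighted geometric mean `b ^ (1 - x) * a ^ x`. -/
noncomputable def geomInterp (a b x : ℝ) : ℝ :=
  Real.exp (Real.log b + x * (Real.log a - Real.log b))

/-- The value at `ν` of the piecewise linear interpolation of `geomInterp a b` at the dyadic points
of level `N`. -/
noncomputable def dyadicInterp (N : ℕ) (a b ν : ℝ) : ℝ :=
  (1 - Int.fract ((2:ℝ)^N * ν)) * geomInterp a b (⌊(2:ℝ)^N * ν⌋ / 2^N)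
    + Int.fract ((2:ℝ)^N * ν) * geomInterp a b ((⌊(2:ℝ)^N * ν⌋ + 1) / 2^N)

lemma geomInterp_eq {a b : ℝ} (ha : 0 < a) (hb : 0 < b) (x : ℝ) :
    geomInterp a b x = b ^ (1 - x) * a ^ x := by
  rw [geomInterp, Real.rpow_def_of_pos ha, Real.rpow_def_of_pos hb, ← Real.exp_add]
  ring_nf

lemma rpow_mul_rpow_rpow_eq_exp_half {a b : ℝ} (ha : 0 < a) (hb : 0 < b) (n : ℕ) (x : ℝ) :
    (b ^ ((2:ℝ)^n - x) * a ^ x) ^ ((1:ℝ)/2^(n+1))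
      = Real.exp ((Real.log b + x / 2^n * (Real.log a - Real.log b)) / 2) := by
  rw [Real.rpow_def_of_pos ha, Real.rpow_def_of_pos hb, ← Real.exp_add, ← Real.exp_mul]
  congr 1
  field_simp
  ring

lemma geomInterp_le_dyadicInterp (N : ℕ) (a b ν : ℝ) :
    geomInterp a b ν ≤ dyadicInterp N a b ν := by
  have h := Real.geom_mean_le_arith_mean2_weighted
    (w₁ := 1 - Int.fract ((2:ℝ)^N * ν)) (w₂ := Int.fract ((2:ℝ)^N * ν))
    (p₁ := geomInterp a b (⌊(2:ℝ)^N * ν⌋ / 2^N))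
    (p₂ := geomInterp a b ((⌊(2:ℝ)^N * ν⌋ + 1) / 2^N))
    (by linarith [Int.fract_lt_one ((2:ℝ)^N * ν)]) (Int.fract_nonneg _)
    (Real.exp_pos _).le (Real.exp_pos _).le (by ring)
  refine le_trans (le_of_eq ?_) h
  simp only [geomInterp]
  rw [← Real.exp_mul, ← Real.exp_mul, ← Real.exp_add, Int.fract]
  congr 1
  field_simp
  ring

lemma dyadicInterp_zero {a b ν : ℝ} (ha : 0 < a) (hb : 0 < b) (h0 : 0 ≤ ν) (h1 : ν ≤ 1) :
    dyadicInterp 0 a b ν = ν * a + (1 - ν) * b := by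
  rcases h1.lt_or_eq with h | rfl
  · have hf : ⌊ν⌋ = 0 := Int.floor_eq_zero_iff.2 ⟨h0, h⟩
    simp [dyadicInterp, geomInterp_eq ha hb, Int.fract, hf]
    ring
  · simp [dyadicInterp, geomInterp_eq ha hb]

lemma dyadicInterp_eq_succ_add {a b : ℝ} (ha : 0 < a) (hb : 0 < b) (N : ℕ) (ν : ℝ) :
    dyadicInterp N a b ν = dyadicInterp (N + 1) a b ν + sj (N + 1) ν *
      ((b ^ ((2:ℝ)^N - (kj (N + 1) ν : ℝ)) * a ^ ((kj (N + 1) ν : ℝ))) ^ ((1:ℝ)/2^(N+1))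
      - (a ^ ((kj (N + 1) ν : ℝ) + 1) * b ^ ((2:ℝ)^N - (kj (N + 1) ν : ℝ) - 1))
          ^ ((1:ℝ)/2^(N+1)))^2 := by
  rw [mul_comm (a ^ _), sub_sub, rpow_mul_rpow_rpow_eq_exp_half ha hb,
    rpow_mul_rpow_rpow_eq_exp_half ha hb]
  simp only [sj, dyadicInterp, geomInterp, rj, kj, Nat.add_sub_cancel, Int.fract]
  have hx : (2:ℝ)^(N+1) * ν = 2 * ((2:ℝ)^N * ν) := by ring
  rw [hx, mul_assoc _ ((2:ℝ)^N) ν]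
  have hl := Int.floor_le ((2:ℝ)^N * ν)
  have hu := Int.lt_floor_add_one ((2:ℝ)^N * ν)
  set x := (2:ℝ)^N * ν
  set k := ⌊x⌋
  set B := Real.log b
  set d := Real.log a - B
  set u := Real.exp ((B + (k:ℝ) / 2^N * d) / 2) with hu'
  set v := Real.exp ((B + ((k:ℝ) + 1) / 2^N * d) / 2) with hv'
  have e0 : Real.exp (B + (k:ℝ) / 2^N * d) = u ^ 2 := by
    rw [hu', ← Real.exp_nat_mul]; congr 1; push_cast; ring
  have e1 : Real.exp (B + ((k:ℝ) + 1) / 2^N * d) = v ^ 2 := by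
    rw [hv', ← Real.exp_nat_mul]; congr 1; push_cast; ring
  have em : Real.exp (B + (2 * (k:ℝ) + 1) / 2^(N+1) * d) = u * v := by
    rw [hu', hv', ← Real.exp_add]; congr 1; field_simp; ring
  have e0' : (2 * (k:ℝ)) / 2^(N+1) = k / 2^N := by field_simp; ring
  have e1' : (2 * (k:ℝ) + 1 + 1) / 2^(N+1) = (k + 1) / 2^N := by field_simp; ring
  rcases lt_or_ge (2 * x) (2 * k + 1) with h | h
  · have hr : ⌊2 * x⌋ = 2 * k := by
      rw [Int.floor_eq_iff]; push_cast; constructor <;> linarith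
    have hs : ⌊(((2 * k : ℤ) : ℝ) + 1) / 2⌋ = k := by
      rw [Int.floor_eq_iff]; push_cast; constructor <;> linarith
    have hp : (-1:ℝ) ^ (2 * k) = 1 := (even_two_mul k).neg_one_zpow
    have hp' : (-1:ℝ) ^ (2 * k + 1) = -1 := (odd_two_mul_add_one k).neg_one_zpow
    rw [hr, hs, hp, hp']
    push_cast
    rw [e0', em, e0, e1]
    ring
  · have hr : ⌊2 * x⌋ = 2 * k + 1 := by
      rw [Int.floor_eq_iff]; push_cast; constructor <;> linarith
    have hs : ⌊(((2 * k + 1 : ℤ) : ℝ) + 1) / 2⌋ = k + 1 := by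
      rw [Int.floor_eq_iff]; push_cast; constructor <;> linarith
    have hp : (-1:ℝ) ^ (2 * k + 1) = -1 := (odd_two_mul_add_one k).neg_one_zpow
    have hp' : (-1:ℝ) ^ (2 * k + 1 + 1) = 1 :=
      (odd_two_mul_add_one k).add_one.neg_one_zpow
    rw [hr, hs, hp, hp']
    push_cast
    rw [e1', em, e0, e1]
    ring

lemma dyadicInterp_add_SS {a b : ℝ} (ha : 0 < a) (hb : 0 < b) (N : ℕ) (ν : ℝ) :
    dyadicInterp N a b ν + SS N ν a b = dyadicInterp 0 a b ν := by
  induction N with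
  | zero => simp [SS]
  | succ N ih =>
    rw [← ih, dyadicInterp_eq_succ_add ha hb N ν, SS, SS,
      Finset.sum_Icc_succ_top (by omega), Nat.add_sub_cancel]
    ring

/-- Multi-term refinement of Young's inequality. -/
lemma young_add_SS_le {a b ν : ℝ} (ha : 0 < a) (hb : 0 < b) (h0 : 0 ≤ ν) (h1 : ν ≤ 1) (N : ℕ) :
    b ^ (1 - ν) * a ^ ν + SS N ν a b ≤ ν * a + (1 - ν) * b := by
  rw [← geomInterp_eq ha hb, ← dyadicInterp_zero ha hb h0 h1, ← dyadicInterp_add_SS ha hb N]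
  linarith [geomInterp_le_dyadicInterp N a b ν]

lemma sq_rpow_mul_mul_rpow {a b : ℝ} (ha : 0 < a) (hb : 0 < b) (ν : ℝ) :
    (b^2) ^ (1 - 2*ν) * (a*b) ^ (2*ν) = (a ^ ν * b ^ (1 - ν))^2 := by
  rw [Real.rpow_def_of_pos (by positivity : 0 < b^2),
    Real.rpow_def_of_pos (by positivity : 0 < a*b), Real.rpow_def_of_pos ha,
    Real.rpow_def_of_pos hb, Real.log_pow, Real.log_mul ha.ne' hb.ne', ← Real.exp_add,
    ← Real.exp_add, ← Real.exp_nat_mul]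
  congr 1
  push_cast
  ring

lemma heinz_sq_add_SS_le {a b ν : ℝ} (ha : 0 < a) (hb : 0 < b) (h0 : 0 ≤ ν) (h1 : ν ≤ 1/2)
    (N : ℕ) :
    (a ^ ν * b ^ (1 - ν) + a ^ (1 - ν) * b ^ ν)^2 + 2 * ν * (a - b)^2
        + SS N (2*ν) (a*b) (a^2) + SS N (2*ν) (a*b) (b^2) ≤ (a + b)^2 := by
  have hab := mul_pos ha hb
  have y1 := young_add_SS_le hab (pow_pos hb 2) (ν := 2*ν) (by linarith) (by linarith) N
  have y2 := young_add_SS_le hab (pow_pos ha 2) (ν := 2*ν) (by linarith) (by linarith) N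
  rw [sq_rpow_mul_mul_rpow ha hb] at y1
  rw [mul_comm a b, sq_rpow_mul_mul_rpow hb ha, mul_comm b a] at y2
  have hc : (a ^ ν * b ^ (1 - ν)) * (b ^ ν * a ^ (1 - ν)) = a * b := by
    have h1 : a ^ ν * a ^ (1 - ν) = a := by rw [← Real.rpow_add ha]; simp
    have h2 : b ^ ν * b ^ (1 - ν) = b := by rw [← Real.rpow_add hb]; simp
    calc _ = (a ^ ν * a ^ (1 - ν)) * (b ^ ν * b ^ (1 - ν)) := by ring
      _ = _ := by rw [h1, h2]
  rw [mul_comm (a ^ (1 - ν)), add_sq, mul_assoc 2 (a ^ ν * b ^ (1 - ν)), hc]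
  linarith

theorem stmt18 (a b ν : ℝ) (ha : 0 < a) (hb : 0 < b) (N : ℕ) :
    (0 ≤ ν → ν ≤ 1/2 →
      (a ^ ν * b ^ (1 - ν) + a ^ (1 - ν) * b ^ ν)^2 + 2 * ν * (a - b)^2
        + SS N (2*ν) (a*b) (a^2) + SS N (2*ν) (a*b) (b^2) ≤ (a + b)^2) ∧
    (1/2 ≤ ν → ν ≤ 1 →
      (a ^ ν * b ^ (1 - ν) + a ^ (1 - ν) * b ^ ν)^2 + 2 * (1 - ν) * (a - b)^2
        + SS N (2 - 2*ν) (a*b) (a^2) + SS N (2 - 2*ν) (a*b) (b^2) ≤ (a + b)^2) := by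
  refine ⟨fun h0 h1 => heinz_sq_add_SS_le ha hb h0 h1 N, fun h0 h1 => ?_⟩
  have h := heinz_sq_add_SS_le ha hb (ν := 1 - ν) (by linarith) (by linarith) N
  rw [sub_sub_cancel, mul_sub, mul_one, add_comm (a ^ (1 - ν) * b ^ ν)] at h
  rw [mul_sub, mul_one]
  exact h
end

section
/- Let A, B be n×n positive semidefinite complex matrices, X an arbitrary n×n complex matrix and N ∈ ℕ. If 0 ≤ ν ≤ 1/2, then ‖A^{ν} X B^{1−ν} + A^{1−ν} X B^{ν}‖₂² + 2ν ‖AX − XB‖₂² + ∑_{j=1}^{N} s_j(2ν) ‖ A^{1−k_j(2ν)/2^{j}} X B^{k_j(2ν)/2^{j}} − A^{1−(k_j(2ν)+1)/2^{j}} X B^{(k_j(2ν)+1)/2^{j}} ‖₂² + ∑_{j=1}^{N} s_j(2ν) ‖ A^{k_j(2ν)/2^{j}} X B^{1−k_j(2ν)/2^{j}} − A^{(k_j(2ν)+1)/2^{j}} X B^{1−(k_j(2ν)+1)/2^{j}} ‖₂² ≤ ‖AX + XB‖₂². If 1/2 ≤ ν ≤ 1, the same inequality holds with 2ν replaced by 2−2ν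 throughout and with the coefficient 2ν of ‖AX − XB‖₂² replaced by 2(1−ν). -/
open Real Finset

open scoped ComplexOrder

noncomputable def mpow {n : Type*} [Fintype n] [DecidableEq n]
    (A : Matrix n n ℂ) (t : ℝ) : Matrix n n ℂ :=
  cfc (fun x : ℝ => x ^ t) A

noncomputable def gm {n : Type*} [Fintype n] [DecidableEq n]
    (A B : Matrix n n ℂ) (t : ℝ) : Matrix n n ℂ :=
  mpow A (1/2) * mpow (mpow A (-(1/2)) * B * mpow A (-(1/2))) t * mpow A (1/2)

noncomputable def hsNorm {n : Type*} [Fintype n] (X : Matrix n n ℂ) : ℝ :=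
  Real.sqrt (∑ i, ∑ j, ‖X i j‖^2)

noncomputable def refinedYoungTerm (j : ℕ) (τ a b : ℝ) : ℝ :=
  a ^ (1 / 2 - (kj j τ : ℝ) / 2 ^ j) * b ^ ((kj j τ : ℝ) / 2 ^ j)
    - a ^ (1 / 2 - ((kj j τ : ℝ) + 1) / 2 ^ j) * b ^ (((kj j τ : ℝ) + 1) / 2 ^ j)

lemma kj_nonneg (j : ℕ) {τ : ℝ} (h : 0 ≤ τ) : (0 : ℝ) ≤ kj j τ := by
  have : 0 ≤ kj j τ := Int.floor_nonneg.2 (by positivity)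
  exact_mod_cast this

lemma kj_succ_add_one_le (j : ℕ) {τ : ℝ} (h : τ < 1) : (kj (j + 1) τ : ℝ) + 1 ≤ 2 ^ j := by
  have : kj (j + 1) τ < 2 ^ j := by
    rw [kj, Int.floor_lt]
    push_cast
    simpa using mul_lt_mul_of_pos_left h (by positivity : (0 : ℝ) < 2 ^ j)
  exact_mod_cast Int.add_one_le_of_lt this

lemma kj_succ_succ (j : ℕ) (τ : ℝ) : kj (j + 2) τ = kj (j + 1) (2 * τ) := by
  simp only [kj, Nat.add_sub_cancel, show j + 2 - 1 = j + 1 from rfl]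
  congr 1; ring

lemma kj_succ_succ' (j : ℕ) (τ : ℝ) : kj (j + 2) τ = kj (j + 1) (2 * τ - 1) + 2 ^ j := by
  simp only [kj, Nat.add_sub_cancel, show j + 2 - 1 = j + 1 from rfl]
  rw [← Int.floor_add_intCast]
  congr 1; push_cast; ring

lemma rj_succ_succ (j : ℕ) (τ : ℝ) : rj (j + 2) τ = rj (j + 1) (2 * τ) := by
  simp only [rj]
  congr 1; ring

lemma rj_succ_succ' (j : ℕ) (τ : ℝ) : rj (j + 2) τ = rj (j + 1) (2 * τ - 1) + 2 * 2 ^ j := by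
  simp only [rj]
  rw [← Int.floor_add_intCast]
  congr 1; push_cast; ring

lemma sj_succ_succ (j : ℕ) (τ : ℝ) : sj (j + 2) τ = sj (j + 1) (2 * τ) := by
  simp only [sj, rj_succ_succ, Nat.add_sub_cancel, show j + 2 - 1 = j + 1 from rfl]
  ring

lemma sj_succ_succ' (j : ℕ) (τ : ℝ) : sj (j + 2) τ = sj (j + 1) (2 * τ - 1) := by
  have h1 : (-1 : ℝ) ^ (2 * 2 ^ j : ℤ) = 1 := Even.neg_one_zpow (even_two_mul _)
  have h2 (r : ℤ) : ⌊(((r + 2 * 2 ^ j : ℤ) : ℝ) + 1) / 2⌋ = ⌊((r : ℝ) + 1) / 2⌋ + 2 ^ j := by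
    rw [← Int.floor_add_intCast]
    congr 1; push_cast; ring
  simp only [sj, rj_succ_succ', Nat.add_sub_cancel, show j + 2 - 1 = j + 1 from rfl, h2]
  rw [add_right_comm (rj _ _), zpow_add₀ (by norm_num) _ (2 * 2 ^ j),
    zpow_add₀ (by norm_num) _ (2 * 2 ^ j), h1, zpow_add_one₀ (by norm_num)]
  push_cast; ring

lemma sj_one_of_lt {τ : ℝ} (h0 : 0 ≤ τ) (h : τ < 1 / 2) : sj 1 τ = τ := by
  have : rj 1 τ = 0 := by
    rw [rj, Int.floor_eq_iff]; constructor <;> norm_num <;> linarith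
  simp only [sj, this]
  norm_num

lemma sj_one_of_le {τ : ℝ} (h0 : 1 / 2 ≤ τ) (h : τ < 1) : sj 1 τ = 1 - τ := by
  have : rj 1 τ = 1 := by
    rw [rj, Int.floor_eq_iff]; constructor <;> norm_num <;> linarith
  simp only [sj, this]
  norm_num
  ring

lemma sj_succ_one (j : ℕ) : sj (j + 1) 1 = 0 := by
  have h : rj (j + 1) 1 = 2 * 2 ^ j := by
    rw [rj, Int.floor_eq_iff]; push_cast; constructor <;> ring_nf <;> norm_num
  have h1 : (-1 : ℝ) ^ (2 * 2 ^ j : ℤ) = 1 := Even.neg_one_zpow (even_two_mul _)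
  have h2 : ⌊(((2 * 2 ^ j : ℤ) : ℝ) + 1) / 2⌋ = 2 ^ j := by
    rw [Int.floor_eq_iff]; push_cast; constructor <;> linarith
  rw [sj, h, zpow_add_one₀ (by norm_num), h1, h2]
  push_cast; simp

lemma rpow_mul_sqrt_mul_rpow {a b x y : ℝ} (ha : 0 ≤ a) (hb : 0 ≤ b) (hx : 0 ≤ x) (hy : 0 ≤ y) :
    a ^ x * √(a * b) ^ y = a ^ (x + y / 2) * b ^ (y / 2) := by
  rw [Real.sqrt_eq_rpow, ← Real.rpow_mul (by positivity), Real.mul_rpow ha hb, ← mul_assoc,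
    ← Real.rpow_add_of_nonneg ha hx (by positivity)]
  ring_nf

lemma refinedYoungTerm_succ_succ (j : ℕ) {τ a b : ℝ} (h0 : 0 ≤ τ) (h1 : τ < 1 / 2)
    (ha : 0 ≤ a) (hb : 0 ≤ b) :
    refinedYoungTerm (j + 2) τ a b = refinedYoungTerm (j + 1) (2 * τ) a √(a * b) := by
  have hk := kj_nonneg (j + 1) (τ := 2 * τ) (by linarith)
  have hk' := kj_succ_add_one_le j (τ := 2 * τ) (by linarith)
  simp only [refinedYoungTerm, kj_succ_succ]
  generalize (kj (j + 1) (2 * τ) : ℝ) = k at *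
  have key (m : ℝ) (hm : 0 ≤ m) (hm' : m ≤ 2 ^ j) :
      a ^ (1 / 2 - m / 2 ^ (j + 2)) * b ^ (m / 2 ^ (j + 2)) =
        a ^ (1 / 2 - m / 2 ^ (j + 1)) * √(a * b) ^ (m / 2 ^ (j + 1)) := by
    have : 0 ≤ 1 / 2 - m / 2 ^ (j + 1) := by
      rw [sub_nonneg, div_le_iff₀ (by positivity), pow_succ]; linarith
    rw [rpow_mul_sqrt_mul_rpow ha hb this (by positivity)]
    congr 2 <;> ring
  rw [key k hk (by linarith), key (k + 1) (by linarith) hk']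

lemma refinedYoungTerm_succ_succ' (j : ℕ) {τ a b : ℝ} (h0 : 1 / 2 ≤ τ) (h1 : τ < 1)
    (ha : 0 ≤ a) (hb : 0 ≤ b) :
    refinedYoungTerm (j + 2) τ a b = refinedYoungTerm (j + 1) (2 * τ - 1) √(a * b) b := by
  have hk := kj_nonneg (j + 1) (τ := 2 * τ - 1) (by linarith)
  have hk' := kj_succ_add_one_le j (τ := 2 * τ - 1) (by linarith)
  simp only [refinedYoungTerm, kj_succ_succ']
  push_cast
  generalize (kj (j + 1) (2 * τ - 1) : ℝ) = k at *
  have key (m : ℝ) (hm : 0 ≤ m) (hm' : m ≤ 2 ^ j) :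
      a ^ (1 / 2 - (m + 2 ^ j) / 2 ^ (j + 2)) * b ^ ((m + 2 ^ j) / 2 ^ (j + 2)) =
        √(a * b) ^ (1 / 2 - m / 2 ^ (j + 1)) * b ^ (m / 2 ^ (j + 1)) := by
    have : 0 ≤ 1 / 2 - m / 2 ^ (j + 1) := by
      rw [sub_nonneg, div_le_iff₀ (by positivity), pow_succ]; linarith
    rw [mul_comm, mul_comm (√_ ^ _), mul_comm a b,
      rpow_mul_sqrt_mul_rpow hb ha (by positivity) this]
    congr 2 <;> field_simp <;> ring
  rw [key k hk (by linarith), add_right_comm, key (k + 1) (by linarith) hk']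

/-- The refined Young inequality of Sababheh and Choi. -/
lemma refined_young (N : ℕ) {τ a b : ℝ} (h0 : 0 ≤ τ) (h1 : τ ≤ 1) (ha : 0 ≤ a) (hb : 0 ≤ b) :
    a ^ (1 - τ) * b ^ τ + ∑ j ∈ range N, sj (j + 1) τ * refinedYoungTerm (j + 1) τ a b ^ 2
      ≤ (1 - τ) * a + τ * b := by
  induction N generalizing τ a b with
  | zero =>
    simpa using Real.geom_mean_le_arith_mean2_weighted (sub_nonneg.2 h1) h0 ha hb (by ring)
  | succ N ih =>
    rcases h1.eq_or_lt with rfl | h1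
    · simp [sj_succ_one]
    have hab : √(a * b) = √a * √b := Real.sqrt_mul ha b
    have hsa := Real.sq_sqrt ha
    have hsb := Real.sq_sqrt hb
    have hs : refinedYoungTerm (0 + 1) τ a b = √a - √b := by
      have : kj 1 τ = 0 := by
        rw [kj, Int.floor_eq_iff]; constructor <;> norm_num <;> linarith
      simp [refinedYoungTerm, this, Real.sqrt_eq_rpow]
    rw [sum_range_succ']
    rcases lt_or_ge τ (1 / 2) with h | h
    · have := ih (τ := 2 * τ) (b := √(a * b)) (by linarith) (by linarith) ha (by positivity)
      rw [rpow_mul_sqrt_mul_rpow ha hb (by linarith) (by linarith)] at this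
      simp only [sj_succ_succ, refinedYoungTerm_succ_succ _ h0 h ha hb, hs, zero_add,
        sj_one_of_lt h0 h]
      ring_nf at this ⊢
      rw [hab] at this
      rw [hsa, hsb]
      rw [hab]
      linarith
    · have := ih (τ := 2 * τ - 1) (a := √(a * b)) (by linarith) (by linarith) (by positivity) hb
      rw [mul_comm (√_ ^ _), mul_comm a b,
        rpow_mul_sqrt_mul_rpow hb ha (by linarith) (by linarith), mul_comm b a] at this
      simp only [sj_succ_succ', refinedYoungTerm_succ_succ' _ h h1 ha hb, hs, zero_add,
        sj_one_of_le h h1]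
      ring_nf at this ⊢
      rw [hab] at this
      rw [hsa, hsb]
      rw [hab]
      linarith

lemma heinz_term_sq (j : ℕ) {τ a b : ℝ} (h0 : 0 ≤ τ) (h1 : τ < 1) (ha : 0 ≤ a) :
    (a ^ (1 - (kj (j + 1) τ : ℝ) / 2 ^ (j + 1)) * b ^ ((kj (j + 1) τ : ℝ) / 2 ^ (j + 1))
      - a ^ (1 - ((kj (j + 1) τ : ℝ) + 1) / 2 ^ (j + 1))
        * b ^ (((kj (j + 1) τ : ℝ) + 1) / 2 ^ (j + 1))) ^ 2
      = a * refinedYoungTerm (j + 1) τ a b ^ 2 := by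
  have hk := kj_nonneg (j + 1) h0
  have hk' := kj_succ_add_one_le j h1
  rw [refinedYoungTerm]
  generalize (kj (j + 1) τ : ℝ) = k at *
  have key (m : ℝ) (hm' : m ≤ 2 ^ j) :
      a ^ (1 - m / 2 ^ (j + 1)) = √a * a ^ (1 / 2 - m / 2 ^ (j + 1)) := by
    have : 0 ≤ 1 / 2 - m / 2 ^ (j + 1) := by
      rw [sub_nonneg, div_le_iff₀ (by positivity), pow_succ]; linarith
    rw [Real.sqrt_eq_rpow, ← Real.rpow_add_of_nonneg ha (by norm_num) this]
    ring_nf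
  rw [key k (by linarith), key (k + 1) hk', mul_assoc, mul_assoc, ← mul_sub, mul_pow,
    Real.sq_sqrt ha]

lemma heinz_sum_le (N : ℕ) {τ a b : ℝ} (h0 : 0 ≤ τ) (h1 : τ ≤ 1) (ha : 0 ≤ a) (hb : 0 ≤ b) :
    ∑ j ∈ Icc 1 N, sj j τ *
      (a ^ (1 - (kj j τ : ℝ) / 2 ^ j) * b ^ ((kj j τ : ℝ) / 2 ^ j)
        - a ^ (1 - ((kj j τ : ℝ) + 1) / 2 ^ j) * b ^ (((kj j τ : ℝ) + 1) / 2 ^ j)) ^ 2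
      ≤ (1 - τ) * a ^ 2 + τ * (a * b) - a ^ (2 - τ) * b ^ τ := by
  rcases h1.eq_or_lt with rfl | h1
  · have hz : ∀ j ∈ Icc 1 N, sj j 1 = 0 := fun j hj => by
      obtain ⟨i, rfl⟩ := Nat.exists_eq_add_of_le' (mem_Icc.1 hj).1
      exact sj_succ_one i
    rw [sum_eq_zero fun j hj => by rw [hz j hj, zero_mul]]
    norm_num
  have hN : Icc 1 N = Ico (0 + 1) (N + 1) := by ext; simp
  have hy := mul_le_mul_of_nonneg_left (refined_young N h0 h1.le ha hb) ha
  rw [hN, ← sum_Ico_add', ← range_eq_Ico]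
  simp only [heinz_term_sq _ h0 h1 ha, mul_left_comm _ a, ← mul_sum]
  have : a ^ (2 - τ) = a * a ^ (1 - τ) := by
    nth_rewrite 2 [← Real.rpow_one a]
    rw [← Real.rpow_add_of_nonneg ha (by norm_num) (by linarith)]
    ring_nf
  rw [this]
  linarith

/-- The scalar refined Heinz inequality. -/
lemma refined_heinz (N : ℕ) {ν a b : ℝ} (h0 : 0 ≤ ν) (h1 : ν ≤ 1 / 2) (ha : 0 ≤ a) (hb : 0 ≤ b) :
    (a ^ ν * b ^ (1 - ν) + a ^ (1 - ν) * b ^ ν) ^ 2 + 2 * ν * (a - b) ^ 2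
      + ∑ j ∈ Icc 1 N, sj j (2 * ν) *
          (a ^ (1 - (kj j (2 * ν) : ℝ) / 2 ^ j) * b ^ ((kj j (2 * ν) : ℝ) / 2 ^ j)
            - a ^ (1 - ((kj j (2 * ν) : ℝ) + 1) / 2 ^ j)
              * b ^ (((kj j (2 * ν) : ℝ) + 1) / 2 ^ j)) ^ 2
      + ∑ j ∈ Icc 1 N, sj j (2 * ν) *
          (a ^ ((kj j (2 * ν) : ℝ) / 2 ^ j) * b ^ (1 - (kj j (2 * ν) : ℝ) / 2 ^ j)
            - a ^ (((kj j (2 * ν) : ℝ) + 1) / 2 ^ j)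
              * b ^ (1 - ((kj j (2 * ν) : ℝ) + 1) / 2 ^ j)) ^ 2
      ≤ (a + b) ^ 2 := by
  have e1 := heinz_sum_le N (τ := 2 * ν) (by linarith) (by linarith) ha hb
  have e2 := heinz_sum_le N (τ := 2 * ν) (by linarith) (by linarith) hb ha
  simp only [mul_comm (b ^ (_ : ℝ)) (a ^ (_ : ℝ))] at e2
  have sq (c x : ℝ) (hc : 0 ≤ c) : (c ^ x) ^ 2 = c ^ (2 * x) := by
    rw [mul_comm, Real.rpow_mul hc, Real.rpow_two]
  have one (c : ℝ) (hc : 0 ≤ c) : c ^ ν * c ^ (1 - ν) = c := by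
    rw [← Real.rpow_add_of_nonneg hc h0 (by linarith)]; simp
  have e3 : (a ^ ν * b ^ (1 - ν) + a ^ (1 - ν) * b ^ ν) ^ 2 =
      a ^ (2 * ν) * b ^ (2 - 2 * ν) + a ^ (2 - 2 * ν) * b ^ (2 * ν) + 2 * (a * b) := by
    rw [show 2 - 2 * ν = 2 * (1 - ν) by ring, ← sq a ν ha, ← sq b ν hb, ← sq a _ ha, ← sq b _ hb]
    linear_combination 2 * (b ^ ν * b ^ (1 - ν)) * one a ha + 2 * a * one b hb
  rw [e3]
  linarith

lemma hsNorm_sq {n : Type*} [Fintype n] (X : Matrix n n ℂ) :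
    hsNorm X ^ 2 = ∑ i, ∑ j, ‖X i j‖ ^ 2 :=
  Real.sq_sqrt (by positivity)

lemma hsNorm_sq_eq_trace {n : Type*} [Fintype n] (X : Matrix n n ℂ) :
    ((hsNorm X ^ 2 : ℝ) : ℂ) = (star X * X).trace := by
  rw [hsNorm_sq, Finset.sum_comm]
  simp [Matrix.trace, Matrix.mul_apply, Matrix.star_apply, Complex.conj_mul']

lemma hsNorm_unitary_mul_mul_star_unitary {n : Type*} [Fintype n] [DecidableEq n]
    (U V : Matrix.unitaryGroup n ℂ) (W : Matrix n n ℂ) :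
    hsNorm ((U : Matrix n n ℂ) * W * star (V : Matrix n n ℂ)) ^ 2 = hsNorm W ^ 2 := by
  have hU : star (U : Matrix n n ℂ) * U = 1 := Unitary.coe_star_mul_self U
  have hV : star (V : Matrix n n ℂ) * V = 1 := Unitary.coe_star_mul_self V
  rw [← Complex.ofReal_inj, hsNorm_sq_eq_trace, hsNorm_sq_eq_trace]
  simp only [star_mul, star_star]
  calc _ = ((V : Matrix n n ℂ) * (star W * (star (U : Matrix n n ℂ) * U) * W * star V.1)).trace := by
        simp only [Matrix.mul_assoc]
    _ = _ := by
        rw [Matrix.trace_mul_comm, hU, Matrix.mul_assoc, hV, Matrix.mul_one, Matrix.mul_one]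

lemma mpow_one_of_posSemidef {n : Type*} [Fintype n] [DecidableEq n] {A : Matrix n n ℂ}
    (hA : A.PosSemidef) : mpow A 1 = A := by
  simp only [mpow, Real.rpow_one]
  exact cfc_id' ℝ A hA.1

lemma mpow_zero_of_posSemidef {n : Type*} [Fintype n] [DecidableEq n] {A : Matrix n n ℂ}
    (hA : A.PosSemidef) : mpow A 0 = 1 := by
  simp only [mpow, Real.rpow_zero]
  exact cfc_const_one ℝ A hA.1

lemma mpow_eq_conj_diagonal {n : Type*} [Fintype n] [DecidableEq n] {A : Matrix n n ℂ}
    (hA : A.PosSemidef) (t : ℝ) :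
    mpow A t = (hA.1.eigenvectorUnitary : Matrix n n ℂ)
      * Matrix.diagonal (fun i => ((hA.1.eigenvalues i ^ t : ℝ) : ℂ))
      * star (hA.1.eigenvectorUnitary : Matrix n n ℂ) := by
  rw [mpow, hA.1.cfc_eq, Matrix.IsHermitian.cfc, Unitary.conjStarAlgAut_apply]
  rfl

lemma exists_hsNorm_sq_eq_sum {n : Type*} [Fintype n] [DecidableEq n]
    {A B : Matrix n n ℂ} (X : Matrix n n ℂ) (hA : A.PosSemidef) (hB : B.PosSemidef) :
    ∃ (l m : n → ℝ) (w : n → n → ℝ), (∀ i, 0 ≤ l i) ∧ (∀ i, 0 ≤ m i) ∧ (∀ i j, 0 ≤ w i j) ∧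
      (∀ p q r s : ℝ, hsNorm (mpow A p * X * mpow B q + mpow A r * X * mpow B s) ^ 2
        = ∑ i, ∑ j, w i j * (l i ^ p * m j ^ q + l i ^ r * m j ^ s) ^ 2) ∧
      (∀ p q r s : ℝ, hsNorm (mpow A p * X * mpow B q - mpow A r * X * mpow B s) ^ 2
        = ∑ i, ∑ j, w i j * (l i ^ p * m j ^ q - l i ^ r * m j ^ s) ^ 2) := by
  set U := hA.1.eigenvectorUnitary
  set V := hB.1.eigenvectorUnitary
  set l := hA.1.eigenvalues
  set m := hB.1.eigenvalues
  set Y := star (U : Matrix n n ℂ) * X * V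
  have key (p q : ℝ) : mpow A p * X * mpow B q = (U : Matrix n n ℂ) *
      Matrix.of (fun i j => ((l i ^ p * m j ^ q : ℝ) : ℂ) * Y i j) * star (V : Matrix n n ℂ) := by
    have : Matrix.of (fun i j => ((l i ^ p * m j ^ q : ℝ) : ℂ) * Y i j)
        = Matrix.diagonal (fun i => ((l i ^ p : ℝ) : ℂ)) * Y
          * Matrix.diagonal (fun i => ((m i ^ q : ℝ) : ℂ)) := by
      ext i j
      simp only [Matrix.of_apply, Matrix.mul_diagonal, Matrix.diagonal_mul]
      push_cast; ring
    rw [this, mpow_eq_conj_diagonal hA, mpow_eq_conj_diagonal hB]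
    simp only [Y, Matrix.mul_assoc, U, V, l, m]
  refine ⟨l, m, fun i j => ‖Y i j‖ ^ 2, hA.eigenvalues_nonneg, hB.eigenvalues_nonneg,
    fun i j => by positivity, fun p q r s => ?_, fun p q r s => ?_⟩
  · rw [key, key, ← Matrix.add_mul, ← Matrix.mul_add, hsNorm_unitary_mul_mul_star_unitary,
      hsNorm_sq]
    refine sum_congr rfl fun i _ => sum_congr rfl fun j _ => ?_
    rw [Matrix.add_apply, Matrix.of_apply, Matrix.of_apply, ← add_mul, ← Complex.ofReal_add,
      norm_mul, Complex.norm_real, mul_pow, Real.norm_eq_abs, sq_abs, mul_comm]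
  · rw [key, key, ← Matrix.sub_mul, ← Matrix.mul_sub, hsNorm_unitary_mul_mul_star_unitary,
      hsNorm_sq]
    refine sum_congr rfl fun i _ => sum_congr rfl fun j _ => ?_
    rw [Matrix.sub_apply, Matrix.of_apply, Matrix.of_apply, ← sub_mul, ← Complex.ofReal_sub,
      norm_mul, Complex.norm_real, mul_pow, Real.norm_eq_abs, sq_abs, mul_comm]

/-- The refined Heinz inequality for the Hilbert–Schmidt norm, in the range `ν ≤ 1 / 2`. -/
lemma refined_heinz_hsNorm {n : Type*} [Fintype n] [DecidableEq n]
    {A B : Matrix n n ℂ} (X : Matrix n n ℂ) (hA : A.PosSemidef) (hB : B.PosSemidef) {ν : ℝ} (N : ℕ)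
    (h0 : 0 ≤ ν) (h1 : ν ≤ 1 / 2) :
    hsNorm (mpow A ν * X * mpow B (1 - ν) + mpow A (1 - ν) * X * mpow B ν) ^ 2
      + 2 * ν * hsNorm (A * X - X * B) ^ 2
      + ∑ j ∈ Icc 1 N, sj j (2 * ν) *
          hsNorm (mpow A (1 - (kj j (2 * ν) : ℝ) / 2 ^ j) * X * mpow B ((kj j (2 * ν) : ℝ) / 2 ^ j)
            - mpow A (1 - ((kj j (2 * ν) : ℝ) + 1) / 2 ^ j) * X
                * mpow B (((kj j (2 * ν) : ℝ) + 1) / 2 ^ j)) ^ 2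
      + ∑ j ∈ Icc 1 N, sj j (2 * ν) *
          hsNorm (mpow A ((kj j (2 * ν) : ℝ) / 2 ^ j) * X * mpow B (1 - (kj j (2 * ν) : ℝ) / 2 ^ j)
            - mpow A (((kj j (2 * ν) : ℝ) + 1) / 2 ^ j) * X
                * mpow B (1 - ((kj j (2 * ν) : ℝ) + 1) / 2 ^ j)) ^ 2
      ≤ hsNorm (A * X + X * B) ^ 2 := by
  obtain ⟨l, m, w, hl, hm, hw, hadd, hsub⟩ := exists_hsNorm_sq_eq_sum X hA hB
  have hadd1 := hadd 1 0 0 1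
  have hsub1 := hsub 1 0 0 1
  simp only [mpow_one_of_posSemidef hA, mpow_one_of_posSemidef hB, mpow_zero_of_posSemidef hA,
    mpow_zero_of_posSemidef hB, Real.rpow_zero, Real.rpow_one,
    mul_one, one_mul] at hadd1 hsub1
  simp only [hadd, hsub, hadd1, hsub1]
  have comm (f : ℕ → ℝ) (g : ℕ → n → n → ℝ) :
      ∑ k ∈ Icc 1 N, f k * ∑ i, ∑ j, w i j * g k i j
        = ∑ i, ∑ j, w i j * ∑ k ∈ Icc 1 N, f k * g k i j := by
    simp only [mul_sum]
    rw [sum_comm]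
    refine sum_congr rfl fun i _ => ?_
    rw [sum_comm]
    exact sum_congr rfl fun j _ => sum_congr rfl fun k _ => mul_left_comm _ _ _
  rw [comm, comm, mul_sum]
  simp only [mul_sum (s := (univ : Finset n))]
  simp only [← sum_add_distrib]
  refine sum_le_sum fun i _ => sum_le_sum fun j _ => ?_
  have := mul_le_mul_of_nonneg_left (refined_heinz N h0 h1 (hl i) (hm j)) (hw i j)
  rw [mul_left_comm (2 * ν), ← mul_add, ← mul_add, ← mul_add]
  exact this

theorem stmt19 {n : Type*} [Fintype n] [DecidableEq n]
    (A B X : Matrix n n ℂ) (hA : A.PosSemidef) (hB : B.PosSemidef) (ν : ℝ) (N : ℕ) :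
    (0 ≤ ν → ν ≤ 1/2 →
      hsNorm (mpow A ν * X * mpow B (1 - ν) + mpow A (1 - ν) * X * mpow B ν)^2
        + 2 * ν * hsNorm (A * X - X * B)^2
        + ∑ j ∈ Finset.Icc 1 N, sj j (2*ν) *
            hsNorm (mpow A (1 - (kj j (2*ν) : ℝ)/2^j) * X * mpow B ((kj j (2*ν) : ℝ)/2^j)
              - mpow A (1 - ((kj j (2*ν) : ℝ) + 1)/2^j) * X
                  * mpow B (((kj j (2*ν) : ℝ) + 1)/2^j))^2
        + ∑ j ∈ Finset.Icc 1 N, sj j (2*ν) *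
            hsNorm (mpow A ((kj j (2*ν) : ℝ)/2^j) * X * mpow B (1 - (kj j (2*ν) : ℝ)/2^j)
              - mpow A (((kj j (2*ν) : ℝ) + 1)/2^j) * X
                  * mpow B (1 - ((kj j (2*ν) : ℝ) + 1)/2^j))^2
        ≤ hsNorm (A * X + X * B)^2) ∧
    (1/2 ≤ ν → ν ≤ 1 →
      hsNorm (mpow A ν * X * mpow B (1 - ν) + mpow A (1 - ν) * X * mpow B ν)^2
        + 2 * (1 - ν) * hsNorm (A * X - X * B)^2
        + ∑ j ∈ Finset.Icc 1 N, sj j (2 - 2*ν) *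
            hsNorm (mpow A (1 - (kj j (2 - 2*ν) : ℝ)/2^j) * X
                  * mpow B ((kj j (2 - 2*ν) : ℝ)/2^j)
              - mpow A (1 - ((kj j (2 - 2*ν) : ℝ) + 1)/2^j) * X
                  * mpow B (((kj j (2 - 2*ν) : ℝ) + 1)/2^j))^2
        + ∑ j ∈ Finset.Icc 1 N, sj j (2 - 2*ν) *
            hsNorm (mpow A ((kj j (2 - 2*ν) : ℝ)/2^j) * X
                  * mpow B (1 - (kj j (2 - 2*ν) : ℝ)/2^j)
              - mpow A (((kj j (2 - 2*ν) : ℝ) + 1)/2^j) * X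
                  * mpow B (1 - ((kj j (2 - 2*ν) : ℝ) + 1)/2^j))^2
        ≤ hsNorm (A * X + X * B)^2) := by
  refine ⟨refined_heinz_hsNorm X hA hB N, fun h0 h1 => ?_⟩
  have := refined_heinz_hsNorm X hA hB (ν := 1 - ν) N (by linarith) (by linarith)
  rw [show 2 * (1 - ν) = 2 - 2 * ν by ring, sub_sub_cancel,
    add_comm (mpow A (1 - ν) * X * _)] at this
  rw [show 2 * (1 - ν) = 2 - 2 * ν by ring]
  exact this
end
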